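/- arXiv:hep-th/0308052 — 2 statements merged into one kernel-verified Lean document; each statement's English description precedes it below -/
import Mathlib

section
/- Let r ≥ 0 and 1 ≤ k ≤ r+1, and for distinct real q₁,…,q_{r+1} define φ_k(q) = ∑_{l=0}^{⌊k/2⌋} ( (r+1−k+2l)! / ( (r+1−k)! 4^l l! ) ) e_{k−2l}(q), where e_m is the degree-m elementary symmetric polynomial in q₁,…,q_{r+1}. Then: (i) Δφ_k = ∑_{j=1}^{r+1} ∂²φ_k/∂q_j² = 0 (φ_k is harmonic); (ii) ∑_{j=1}^{r+1} ( q_j − ∑_{l≠j} 1/(q_j − q_l) ) ∂φ_k/∂q_j = k φ_k, i.e. φ_k is a classical eigenfunction of the reduced A_r Calogero system with eigenvalue k; and consequently (iii) for every ℏ > 0, −(ℏ²/2)Δφ_k − ℏ ∑_j ∂W/∂q_j ∂φ_k/∂q_j = kℏ φ_k, so φ_k is simultaneously a quantum eigenfunction with eigenvalue kℏ. -/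
/-- Partial derivative `∂f/∂q_j` of a function on `ℝ^r`. -/
noncomputable def pd {r : ℕ} (f : (Fin r → ℝ) → ℝ) (j : Fin r) (q : Fin r → ℝ) : ℝ :=
  fderiv ℝ f q (Pi.single j 1)

/-- The degree-`k` elementary symmetric polynomial of `q₁,…,q_n`. -/
noncomputable def esym {n : ℕ} (k : ℕ) (q : Fin n → ℝ) : ℝ :=
  ∑ t ∈ Finset.univ.powersetCard k, ∏ i ∈ t, q i

/-- The degree-`m` elementary symmetric polynomial in the variables `q i`, `i ∈ s`. -/
noncomputable def esymOn {n : ℕ} (s : Finset (Fin n)) (m : ℕ) (q : Fin n → ℝ) : ℝ :=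
  ∑ t ∈ s.powersetCard m, ∏ i ∈ t, q i

/-- The partial derivative of the degree-`m` elementary symmetric polynomial in `q j`. -/
noncomputable def esymDeriv {n : ℕ} : ℕ → Fin n → (Fin n → ℝ) → ℝ
  | 0, _, _ => 0
  | m + 1, j, q => esymOn (Finset.univ.erase j) m q

section esymOn

variable {n : ℕ}

lemma esymOn_zero (s : Finset (Fin n)) (q : Fin n → ℝ) : esymOn s 0 q = 1 := by
  simp [esymOn]

lemma esymOn_insert {s : Finset (Fin n)} {a : Fin n} (ha : a ∉ s) (m : ℕ) (q : Fin n → ℝ) :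
    esymOn (insert a s) (m + 1) q = esymOn s (m + 1) q + q a * esymOn s m q := by
  have hmem : ∀ t ∈ s.powersetCard m, a ∉ t := fun t ht h =>
    ha ((Finset.mem_powersetCard.1 ht).1 h)
  unfold esymOn
  rw [Finset.powersetCard_succ_insert ha, Finset.sum_union, Finset.sum_image, Finset.mul_sum]
  · congr 1
    exact Finset.sum_congr rfl fun t ht => Finset.prod_insert (hmem t ht)
  · intro t ht u hu htu
    rw [← Finset.erase_insert (hmem t ht), ← Finset.erase_insert (hmem u hu)]
    exact congrArg (fun v => v.erase a) htu
  · rw [Finset.disjoint_left]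
    intro t ht ht'
    obtain ⟨u, -, rfl⟩ := Finset.mem_image.1 ht'
    exact ha ((Finset.mem_powersetCard.1 ht).1 (Finset.mem_insert_self a u))

lemma esymOn_succ_of_mem {s : Finset (Fin n)} {a : Fin n} (ha : a ∈ s) (m : ℕ)
    (q : Fin n → ℝ) :
    esymOn s (m + 1) q = esymOn (s.erase a) (m + 1) q + q a * esymOn (s.erase a) m q := by
  conv_lhs => rw [← Finset.insert_erase ha]
  exact esymOn_insert (Finset.notMem_erase a s) m q

lemma differentiable_esymOn (s : Finset (Fin n)) (m : ℕ) :
    Differentiable ℝ (esymOn s m) := by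
  unfold esymOn
  fun_prop

lemma esymOn_add_single {s : Finset (Fin n)} {j : Fin n} (hj : j ∉ s) (m : ℕ)
    (q : Fin n → ℝ) (t : ℝ) :
    esymOn s m (q + t • Pi.single j 1) = esymOn s m q := by
  refine Finset.sum_congr rfl fun u hu => Finset.prod_congr rfl fun i hi => ?_
  have hij : i ≠ j := by
    rintro rfl
    exact hj ((Finset.mem_powersetCard.1 hu).1 hi)
  simp [hij]

/-- Euler's identity for the elementary symmetric polynomials. -/
lemma sum_mul_esymOn_erase (s : Finset (Fin n)) (m : ℕ) (q : Fin n → ℝ) :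
    ∑ j ∈ s, q j * esymOn (s.erase j) m q = (m + 1) * esymOn s (m + 1) q := by
  induction s using Finset.induction_on generalizing m with
  | empty =>
    have h : Finset.powersetCard (m + 1) (∅ : Finset (Fin n)) = ∅ :=
      Finset.powersetCard_eq_empty.2 (by simp)
    simp [esymOn, h]
  | insert a s ha ih =>
    rw [Finset.sum_insert ha, Finset.erase_insert ha, esymOn_insert ha]
    have herase : ∀ j ∈ s, (insert a s).erase j = insert a (s.erase j) := fun j hj =>
      Finset.erase_insert_of_ne (by rintro rfl; exact ha hj)
    cases m with
    | zero =>
      have h := ih 0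
      simp only [esymOn_zero] at h ⊢
      linear_combination h
    | succ m =>
      have h : ∑ j ∈ s, q j * esymOn ((insert a s).erase j) (m + 1) q
          = ∑ j ∈ s, q j * esymOn (s.erase j) (m + 1) q
            + q a * ∑ j ∈ s, q j * esymOn (s.erase j) m q := by
        rw [Finset.mul_sum, ← Finset.sum_add_distrib]
        refine Finset.sum_congr rfl fun j hj => ?_
        rw [herase j hj, esymOn_insert (fun h => ha (Finset.mem_of_mem_erase h))]
        ring
      rw [h, ih, ih]
      push_cast
      ring

lemma sum_esymOn_erase (s : Finset (Fin n)) (m : ℕ) (q : Fin n → ℝ) :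
    ∑ j ∈ s, esymOn (s.erase j) m q = ((s.card : ℝ) - m) * esymOn s m q := by
  cases m with
  | zero => simp [esymOn_zero]
  | succ m =>
    have h : ∑ j ∈ s, esymOn s (m + 1) q
        = ∑ j ∈ s, esymOn (s.erase j) (m + 1) q + ∑ j ∈ s, q j * esymOn (s.erase j) m q := by
      rw [← Finset.sum_add_distrib]
      exact Finset.sum_congr rfl fun j hj => esymOn_succ_of_mem hj m q
    rw [sum_mul_esymOn_erase, Finset.sum_const, nsmul_eq_mul] at h
    push_cast
    linear_combination -h

end esymOn

section pd

variable {n : ℕ}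

lemma pd_eq_of_affine {f : (Fin n → ℝ) → ℝ} {j : Fin n} {q : Fin n → ℝ} {c : ℝ}
    (hf : DifferentiableAt ℝ f q) (h : ∀ t : ℝ, f (q + t • Pi.single j 1) = f q + t * c) :
    pd f j q = c := by
  rw [pd, ← hf.lineDeriv_eq_fderiv, lineDeriv]
  simp_rw [h]
  simp

lemma esym_add_single (m : ℕ) (j : Fin n) (q : Fin n → ℝ) (t : ℝ) :
    esym m (q + t • Pi.single j 1) = esym m q + t * esymDeriv m j q := by
  change esymOn Finset.univ m _ = esymOn Finset.univ m q + _
  cases m with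
  | zero => simp [esymOn_zero, esymDeriv]
  | succ m =>
    rw [esymOn_succ_of_mem (Finset.mem_univ j), esymOn_succ_of_mem (Finset.mem_univ j),
      esymOn_add_single (Finset.notMem_erase j _), esymOn_add_single (Finset.notMem_erase j _)]
    simp [esymDeriv]
    ring

lemma esymDeriv_add_single (m : ℕ) (j : Fin n) (q : Fin n → ℝ) (t : ℝ) :
    esymDeriv m j (q + t • Pi.single j 1) = esymDeriv m j q := by
  cases m with
  | zero => rfl
  | succ m => exact esymOn_add_single (Finset.notMem_erase j _) m q t

lemma differentiable_esym (m : ℕ) : Differentiable ℝ (esym (n := n) m) :=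
  differentiable_esymOn Finset.univ m

lemma differentiable_esymDeriv (m : ℕ) (j : Fin n) : Differentiable ℝ (esymDeriv m j) := by
  cases m with
  | zero => exact differentiable_const 0
  | succ m => exact differentiable_esymOn _ m

end pd

section classical

variable {n : ℕ}

lemma sum_mul_esymDeriv (m : ℕ) (q : Fin n → ℝ) :
    ∑ j, q j * esymDeriv m j q = m * esym m q := by
  cases m with
  | zero => simp [esymDeriv]
  | succ m =>
    push_cast
    exact sum_mul_esymOn_erase Finset.univ m q

lemma sum_sum_erase_comm (F : Fin n → Fin n → ℝ) :
    ∑ j, ∑ l ∈ Finset.univ.erase j, F j l = ∑ j, ∑ l ∈ Finset.univ.erase j, F l j := by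
  refine Finset.sum_comm' fun j l => ?_
  simp [eq_comm]

lemma sum_interaction_esymDeriv_one (q : Fin n → ℝ) :
    ∑ j, (∑ l ∈ Finset.univ.erase j, 1 / (q j - q l)) * esymDeriv 1 j q = 0 := by
  have h := sum_sum_erase_comm fun j l => 1 / (q j - q l)
  have h' : ∑ j, ∑ l ∈ Finset.univ.erase j, 1 / (q l - q j)
      = -∑ j, ∑ l ∈ Finset.univ.erase j, 1 / (q j - q l) := by
    simp_rw [← Finset.sum_neg_distrib]
    refine Finset.sum_congr rfl fun j _ => Finset.sum_congr rfl fun l _ => ?_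
    rw [← neg_sub (q j) (q l), div_neg]
  simp only [esymDeriv, esymOn_zero, mul_one]
  linarith

lemma sum_interaction_esymDeriv (m : ℕ) {q : Fin n → ℝ} (hq : Function.Injective q) :
    ∑ j, (∑ l ∈ Finset.univ.erase j, 1 / (q j - q l)) * esymDeriv (m + 2) j q
      = -(1 / 2) * ((n : ℝ) - 1 - m) * (n - m) * esym m q := by
  simp_rw [Finset.sum_mul]
  have hswap := sum_sum_erase_comm fun j l => 1 / (q j - q l) * esymDeriv (m + 2) j q
  have hpair : ∑ j, ∑ l ∈ Finset.univ.erase j, 1 / (q j - q l) * esymDeriv (m + 2) j q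
        + ∑ j, ∑ l ∈ Finset.univ.erase j, 1 / (q l - q j) * esymDeriv (m + 2) l q
      = -∑ j, ∑ l ∈ Finset.univ.erase j, esymOn ((Finset.univ.erase j).erase l) m q := by
    simp_rw [← Finset.sum_neg_distrib, ← Finset.sum_add_distrib]
    refine Finset.sum_congr rfl fun j _ => Finset.sum_congr rfl fun l hl => ?_
    have hlj : l ≠ j := Finset.ne_of_mem_erase hl
    have h₁ : q j - q l ≠ 0 := sub_ne_zero.2 fun h => hlj (hq h).symm
    have h₂ : q l - q j ≠ 0 := sub_ne_zero.2 fun h => hlj (hq h)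
    simp only [esymDeriv]
    rw [esymOn_succ_of_mem hl,
      esymOn_succ_of_mem (Finset.mem_erase.2 ⟨hlj.symm, Finset.mem_univ j⟩),
      Finset.erase_right_comm (a := l) (b := j), ← neg_sub (q j) (q l)]
    field_simp
    ring
  have hcard : ∀ j : Fin n, ((Finset.univ.erase j).card : ℝ) = n - 1 := fun j => by
    have := Finset.card_erase_add_one (Finset.mem_univ j)
    rw [Finset.card_univ, Fintype.card_fin] at this
    exact eq_sub_of_add_eq (by exact_mod_cast this)
  have hsum : ∑ j : Fin n, ∑ l ∈ Finset.univ.erase j,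
      esymOn ((Finset.univ.erase j).erase l) m q = ((n : ℝ) - 1 - m) * (n - m) * esym m q := by
    simp_rw [sum_esymOn_erase, hcard]
    rw [← Finset.mul_sum, sum_esymOn_erase, Finset.card_univ, Fintype.card_fin, mul_assoc]
    rfl
  rw [hsum] at hpair
  linarith

/-- The part of degree `m - 2` of the classical operator applied to `esym m`. -/
noncomputable def esymLower : ℕ → (Fin n → ℝ) → ℝ
  | 0, _ => 0
  | 1, _ => 0
  | m + 2, q => (1 / 2) * ((n : ℝ) - 1 - m) * (n - m) * esym m q

lemma classical_esymDeriv (m : ℕ) {q : Fin n → ℝ} (hq : Function.Injective q) :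
    ∑ j, (q j - ∑ l ∈ Finset.univ.erase j, 1 / (q j - q l)) * esymDeriv m j q
      = m * esym m q + esymLower m q := by
  simp_rw [sub_mul]
  rw [Finset.sum_sub_distrib, sum_mul_esymDeriv]
  match m with
  | 0 => simp [esymDeriv, esymLower]
  | 1 => rw [sum_interaction_esymDeriv_one]; simp [esymLower]
  | m + 2 => rw [sum_interaction_esymDeriv m hq]; simp only [esymLower]; ring

end classical

/-- The coefficient of `esym (k - 2 * l)` in the `k`-th elementary excitation of `n` particles. -/
noncomputable def excitationCoeff (n k l : ℕ) : ℝ :=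
  ((n - k + 2 * l).factorial : ℝ) / (((n - k).factorial : ℝ) * 4 ^ l * (l.factorial : ℝ))

lemma excitationCoeff_succ {n k : ℕ} (hk : k ≤ n) (l : ℕ) :
    excitationCoeff n k (l + 1) * (2 * (l + 1))
      = excitationCoeff n k l * ((1 / 2) * ((n : ℝ) - k + 2 * l + 1) * (n - k + 2 * l + 2)) := by
  obtain ⟨a, rfl⟩ := Nat.exists_eq_add_of_le hk
  have h₁ : (a.factorial : ℝ) ≠ 0 := by positivity
  have h₂ : (l.factorial : ℝ) ≠ 0 := by positivity
  have h₃ : (l : ℝ) + 1 ≠ 0 := by positivity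
  simp only [excitationCoeff, Nat.add_sub_cancel_left,
    show a + 2 * (l + 1) = (a + 2 * l + 1) + 1 by ring, Nat.factorial_succ]
  push_cast
  field_simp
  ring

lemma sum_excitationCoeff_classical {n k : ℕ} (hk : k ≤ n) (q : Fin n → ℝ) :
    ∑ l ∈ Finset.range (k / 2 + 1), excitationCoeff n k l *
        (((k - 2 * l : ℕ) : ℝ) * esym (k - 2 * l) q + esymLower (k - 2 * l) q)
      = k * ∑ l ∈ Finset.range (k / 2 + 1), excitationCoeff n k l * esym (k - 2 * l) q := by
  have hdiff : ∑ l ∈ Finset.range (k / 2 + 1),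
        excitationCoeff n k l * esymLower (k - 2 * l) q
      = ∑ l ∈ Finset.range (k / 2 + 1),
        excitationCoeff n k l * (2 * l) * esym (k - 2 * l) q := by
    rw [Finset.sum_range_succ, Finset.sum_range_succ']
    have hlast : esymLower (k - 2 * (k / 2)) q = 0 := by
      rcases (by lia : k - 2 * (k / 2) = 0 ∨ k - 2 * (k / 2) = 1) with h | h <;>
        rw [h] <;> rfl
    rw [hlast]
    simp only [mul_zero, Nat.cast_zero, zero_mul, add_zero]
    refine Finset.sum_congr rfl fun l hl => ?_
    have hl' := Finset.mem_range.1 hl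
    obtain ⟨m, hm⟩ := Nat.exists_eq_add_of_le (show 2 * l + 2 ≤ k by lia)
    rw [show k - 2 * l = m + 2 by lia, show k - 2 * (l + 1) = m by lia, Nat.cast_succ,
      excitationCoeff_succ hk, esymLower]
    have hm' : (k : ℝ) = 2 * l + 2 + m := by exact_mod_cast hm
    rw [hm']
    ring
  simp_rw [mul_add]
  rw [Finset.sum_add_distrib, hdiff, ← Finset.sum_add_distrib, Finset.mul_sum]
  refine Finset.sum_congr rfl fun l hl => ?_
  have hl' := Finset.mem_range.1 hl
  rw [Nat.cast_sub (by lia)]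
  push_cast
  ring

/-- The elementary excitations of the reduced `A_r` Calogero system:
`φ_k = ∑_l ((r+1−k+2l)!/((r+1−k)! 4^l l!)) S_{k−2l}` is (i) harmonic, (ii) a classical
eigenfunction of `Â = −∇W·∇` with eigenvalue `k`, and (iii) a quantum eigenfunction of
`Ĥ = −(ℏ²/2)Δ + ℏÂ` with eigenvalue `kℏ`. -/
theorem A_series_elementary_excitations (r k : ℕ) (hk1 : 1 ≤ k) (hk2 : k ≤ r + 1)
    (φ : (Fin (r+1) → ℝ) → ℝ)
    (hφ : ∀ q, φ q = ∑ l ∈ Finset.range (k / 2 + 1),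
        (((r + 1 - k + 2*l).factorial : ℝ) /
          (((r + 1 - k).factorial : ℝ) * 4^l * (l.factorial : ℝ))) * esym (k - 2*l) q) :
    ∀ q : Fin (r+1) → ℝ, Function.Injective q →
      (∑ j, pd (pd φ j) j q = 0)
      ∧ (∑ j, (q j - ∑ l ∈ Finset.univ.erase j, 1 / (q j - q l)) * pd φ j q
          = (k : ℝ) * φ q)
      ∧ (∀ ℏ : ℝ, 0 < ℏ →
          -(ℏ^2/2) * (∑ j, pd (pd φ j) j q)
            + ℏ * (∑ j, (q j - ∑ l ∈ Finset.univ.erase j, 1 / (q j - q l)) * pd φ j q)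
          = (k : ℝ) * ℏ * φ q) := by
  intro q hq
  have hφ' : φ = fun q => ∑ l ∈ Finset.range (k / 2 + 1),
      excitationCoeff (r + 1) k l * esym (k - 2 * l) q := funext hφ
  have hpd : ∀ j, pd φ j = fun q => ∑ l ∈ Finset.range (k / 2 + 1),
      excitationCoeff (r + 1) k l * esymDeriv (k - 2 * l) j q := by
    intro j
    funext q
    have hdiff : ∀ m, Differentiable ℝ (esym (n := r + 1) m) := differentiable_esym
    rw [hφ']
    refine pd_eq_of_affine (by fun_prop) fun t => ?_
    simp only [esym_add_single]
    rw [Finset.mul_sum, ← Finset.sum_add_distrib]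
    exact Finset.sum_congr rfl fun l _ => by ring
  have hharm : ∑ j, pd (pd φ j) j q = 0 := by
    refine Finset.sum_eq_zero fun j _ => ?_
    have hdiff : ∀ m, Differentiable ℝ (esymDeriv (n := r + 1) m j) :=
      fun m => differentiable_esymDeriv m j
    rw [hpd]
    exact pd_eq_of_affine (by fun_prop) fun t => by simp only [esymDeriv_add_single]; ring
  have hclass : ∑ j, (q j - ∑ l ∈ Finset.univ.erase j, 1 / (q j - q l)) * pd φ j q
      = (k : ℝ) * φ q := by
    simp_rw [hpd, Finset.mul_sum]
    rw [Finset.sum_comm, hφ', ← sum_excitationCoeff_classical hk2]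
    refine Finset.sum_congr rfl fun l _ => ?_
    rw [← classical_esymDeriv _ hq, Finset.mul_sum]
    exact Finset.sum_congr rfl fun j _ => by ring
  refine ⟨hharm, hclass, fun ℏ _ => ?_⟩
  rw [hharm, hclass]
  ring
end

section
/- Let r ≥ 2, γ > 0, and let q ∈ ℝ^r be such that cos 2q_j are pairwise distinct and sin q_j ≠ 0, cos q_j ≠ 0 for all j. Define the B_r Sutherland prepotential W = ∑_{j<k}^r log( cos 2q_j − cos 2q_k ) + γ ∑_{j=1}^r log sin q_j, and φ(q) = ∏_{j=1}^r cos q_j. Then: (i) Δφ = ∑_{j=1}^r ∂²φ/∂q_j² = −r φ; (ii) −∑_{j=1}^r ∂W/∂q_j ∂φ/∂q_j = r(r+γ−1) φ. Consequently, for every ℏ > 0, −(ℏ²/2)Δφ − ℏ∑_j (∂W/∂q_j)(∂φ/∂q_j) = rℏ( r + γ + ℏ/2 − 1 ) φ: the function ∏_j cos q_j, corresponding to the spinor weight of B_r, is simultaneously a classical and quantum eigenfunction with no quantum corrections to its functional form. -/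
open Finset in
/-- Partial derivatives of a product of functions of one coordinate each. -/
theorem pd_prod_apply {r : ℕ} (f f' : Fin r → ℝ → ℝ) (q : Fin r → ℝ)
    (h : ∀ i, HasDerivAt (f i) (f' i (q i)) (q i)) (j : Fin r) :
    pd (fun p => ∏ i, f i (p i)) j q = f' j (q j) * ∏ i ∈ univ.erase j, f i (q i) := by
  have hf : ∀ i ∈ (univ : Finset (Fin r)), HasFDerivAt (fun p : Fin r → ℝ => f i (p i))
      (f' i (q i) • ContinuousLinearMap.proj (R := ℝ) (φ := fun _ : Fin r => ℝ) i) q :=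
    fun i _ => (h i).comp_hasFDerivAt q (hasFDerivAt_apply i q)
  rw [pd, (HasFDerivAt.finsetProd hf).fderiv]
  simp [Pi.single_apply, mul_comm]

/-- First partial derivatives of `∏ cos`. -/
theorem pd_prod_cos {r : ℕ} (j : Fin r) (q : Fin r → ℝ) :
    pd (fun p => ∏ i, Real.cos (p i)) j q
      = -Real.sin (q j) * ∏ i ∈ Finset.univ.erase j, Real.cos (q i) :=
  pd_prod_apply (fun _ => Real.cos) (fun _ x => -Real.sin x) q
    (fun i => Real.hasDerivAt_cos (q i)) j

/-- `∏ cos` is an eigenfunction of each `∂²/∂q_j²`, with eigenvalue `-1`. -/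
theorem pd_pd_prod_cos {r : ℕ} (j : Fin r) (q : Fin r → ℝ) :
    pd (pd (fun p => ∏ i, Real.cos (p i)) j) j q = -∏ i, Real.cos (q i) := by
  have hfun : pd (fun p : Fin r → ℝ => ∏ i, Real.cos (p i)) j
      = fun p => ∏ i, (if i = j then fun x => -Real.sin x else Real.cos) (p i) := by
    funext p
    rw [pd_prod_cos, ← Finset.mul_prod_erase _ _ (Finset.mem_univ j), if_pos rfl]
    congr 1
    exact Finset.prod_congr rfl fun i hi => by rw [if_neg (Finset.ne_of_mem_erase hi)]
  rw [hfun, pd_prod_apply _ (fun i x => if i = j then -Real.cos x else -Real.sin x),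
    ← Finset.mul_prod_erase _ _ (Finset.mem_univ j), if_pos rfl, neg_mul]
  · congr 2
    exact Finset.prod_congr rfl fun i hi => by rw [if_neg (Finset.ne_of_mem_erase hi)]
  · intro i
    split_ifs
    · exact (Real.hasDerivAt_sin (q i)).neg
    · exact Real.hasDerivAt_cos (q i)

/-- Contracting the partial derivatives with a vector gives the directional derivative. -/
theorem sum_pd_mul {r : ℕ} (f : (Fin r → ℝ) → ℝ) (q a : Fin r → ℝ) :
    ∑ j, pd f j q * a j = fderiv ℝ f q a := by
  conv_rhs => rw [pi_eq_sum_univ' a, map_sum]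
  refine Finset.sum_congr rfl fun j _ => ?_
  rw [map_smul, smul_eq_mul, mul_comm, pd]

/-- Directional derivative of the `B_r` Sutherland prepotential. -/
theorem fderiv_prepotential_apply {r : ℕ} (γ : ℝ) (q : Fin r → ℝ)
    (hqd : Function.Injective fun j => Real.cos (2 * q j))
    (hsin : ∀ j, Real.sin (q j) ≠ 0) (a : Fin r → ℝ) :
    fderiv ℝ (fun p : Fin r → ℝ =>
        (∑ j, ∑ l ∈ Finset.Ioi j, Real.log (Real.cos (2 * p j) - Real.cos (2 * p l)))
          + γ * (∑ j, Real.log (Real.sin (p j)))) q a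
      = (∑ j, ∑ l ∈ Finset.Ioi j, (2 * Real.sin (2 * q l) * a l - 2 * Real.sin (2 * q j) * a j)
            / (Real.cos (2 * q j) - Real.cos (2 * q l)))
          + γ * ∑ j, Real.cos (q j) * a j / Real.sin (q j) := by
  have hproj : ∀ i, HasFDerivAt (fun p : Fin r → ℝ => p i)
      (ContinuousLinearMap.proj (R := ℝ) (φ := fun _ : Fin r => ℝ) i) q :=
    fun i => hasFDerivAt_apply i q
  have hpair : ∀ j, ∀ l ∈ Finset.Ioi j, HasFDerivAt
      (fun p : Fin r → ℝ => Real.log (Real.cos (2 * p j) - Real.cos (2 * p l))) _ q :=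
    fun j l hl => ((((hproj j).const_mul 2).cos).sub (((hproj l).const_mul 2).cos)).log
      (sub_ne_zero.2 fun h => (Finset.mem_Ioi.1 hl).ne (hqd h))
  have hsingle : ∀ j ∈ (Finset.univ : Finset (Fin r)), HasFDerivAt
      (fun p : Fin r → ℝ => Real.log (Real.sin (p j))) _ q :=
    fun j _ => ((hproj j).sin).log (hsin j)
  rw [((HasFDerivAt.fun_sum fun j (_ : j ∈ Finset.univ) => HasFDerivAt.fun_sum (hpair j)).fun_add
    ((HasFDerivAt.fun_sum hsingle).const_mul γ)).fderiv]
  simp only [add_apply, sum_apply,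
    smul_apply, sub_apply,
    ContinuousLinearMap.proj_apply, smul_eq_mul, Pi.sub_apply]
  congr 1
  · refine Finset.sum_congr rfl fun j _ => Finset.sum_congr rfl fun l _ => ?_
    ring
  · congr 1
    refine Finset.sum_congr rfl fun j _ => ?_
    ring

/-- The number of pairs `j < l` in `Fin r`. -/
theorem two_mul_sum_card_Ioi (r : ℕ) :
    2 * ∑ j : Fin r, ((Finset.Ioi j).card : ℝ) = (r : ℝ) * ((r : ℝ) - 1) := by
  have h : ∀ j : Fin r, ((Finset.Ioi j).card : ℝ) = (r : ℝ) - 1 - ((j : ℕ) : ℝ) := by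
    intro j
    have hj := j.isLt
    have : (Finset.Ioi j).card + 1 + j = r := by rw [Fin.card_Ioi]; omega
    have : ((Finset.Ioi j).card : ℝ) + 1 + (j : ℕ) = r := mod_cast this
    linarith
  simp only [h]
  rw [Fin.sum_univ_eq_sum_range (fun j => (r : ℝ) - 1 - (j : ℝ)) r]
  rw [Finset.sum_sub_distrib, Finset.sum_const, Finset.card_range, nsmul_eq_mul]
  have h := congrArg (Nat.cast : ℕ → ℝ) (Finset.sum_range_id_mul_two r)
  rcases r with _ | n
  · simp
  · rw [Nat.add_sub_cancel] at h
    push_cast at h ⊢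
    linarith

/-- The classical eigenvalue equation, for the gradient of `∏ cos` in closed form. -/
theorem sum_pd_prepotential_mul_pd_prod_cos {r : ℕ} (γ : ℝ) (q : Fin r → ℝ)
    (hqd : Function.Injective fun j => Real.cos (2 * q j))
    (hsin : ∀ j, Real.sin (q j) ≠ 0) :
    ∑ j, pd (fun p : Fin r → ℝ =>
        (∑ j, ∑ l ∈ Finset.Ioi j, Real.log (Real.cos (2 * p j) - Real.cos (2 * p l)))
          + γ * (∑ j, Real.log (Real.sin (p j)))) j q * pd (fun p => ∏ i, Real.cos (p i)) j q
      = -((r : ℝ) * ((r : ℝ) + γ - 1) * ∏ i, Real.cos (q i)) := by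
  rw [sum_pd_mul _ q fun j => pd (fun p => ∏ i, Real.cos (p i)) j q,
    fderiv_prepotential_apply γ q hqd hsin]
  have hcos : ∀ j, Real.cos (q j) * pd (fun p => ∏ i, Real.cos (p i)) j q
      = -Real.sin (q j) * ∏ i, Real.cos (q i) := fun j => by
    rw [pd_prod_cos, ← Finset.mul_prod_erase _ _ (Finset.mem_univ j)]
    ring
  have hsin2 : ∀ j, 2 * Real.sin (2 * q j) * pd (fun p => ∏ i, Real.cos (p i)) j q
      = -2 * (1 - Real.cos (2 * q j)) * ∏ i, Real.cos (q i) := fun j => by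
    rw [Real.sin_two_mul, Real.cos_two_mul]
    linear_combination (4 * Real.sin (q j)) * hcos j
      - 4 * (∏ i, Real.cos (q i)) * Real.sin_sq_add_cos_sq (q j)
  have hpair : ∀ j, ∀ l ∈ Finset.Ioi j,
      (2 * Real.sin (2 * q l) * pd (fun p => ∏ i, Real.cos (p i)) l q
        - 2 * Real.sin (2 * q j) * pd (fun p => ∏ i, Real.cos (p i)) j q)
        / (Real.cos (2 * q j) - Real.cos (2 * q l)) = -2 * ∏ i, Real.cos (q i) := by
    intro j l hl
    rw [hsin2, hsin2, div_eq_iff (sub_ne_zero.2 fun h => (Finset.mem_Ioi.1 hl).ne (hqd h))]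
    ring
  have hsingle : ∀ j, Real.cos (q j) * pd (fun p => ∏ i, Real.cos (p i)) j q / Real.sin (q j)
      = -∏ i, Real.cos (q i) := fun j => by
    rw [hcos, div_eq_iff (hsin j)]
    ring
  rw [Finset.sum_congr rfl fun j _ => Finset.sum_congr rfl (hpair j),
    Finset.sum_congr rfl fun j _ => hsingle j]
  simp only [Finset.sum_const, nsmul_eq_mul, Finset.card_univ, Fintype.card_fin,
    ← Finset.sum_mul]
  linear_combination (-∏ i, Real.cos (q i)) * two_mul_sum_card_Ioi r

/-- The spinor-weight eigenfunction `φ = ∏_j cos q_j` of the reduced `B_r` Sutherland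
system satisfies (i) `Δφ = −rφ`, (ii) `Âφ = r(r+γ−1)φ`, and hence (iii)
`Ĥφ = rℏ(r+γ+ℏ/2−1)φ`: it is simultaneously a classical and quantum eigenfunction
with no quantum corrections to its functional form. -/
theorem B_series_sutherland_spinor (r : ℕ) (hr : 2 ≤ r) (γ : ℝ) (hγ : 0 < γ)
    (q : Fin r → ℝ)
    (hqd : Function.Injective fun j => Real.cos (2 * q j))
    (hsin : ∀ j, Real.sin (q j) ≠ 0) (hcos : ∀ j, Real.cos (q j) ≠ 0)
    (W φ : (Fin r → ℝ) → ℝ)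
    (hW : ∀ p, W p =
        (∑ j, ∑ l ∈ Finset.Ioi j, Real.log (Real.cos (2 * p j) - Real.cos (2 * p l)))
          + γ * (∑ j, Real.log (Real.sin (p j))))
    (hφ : ∀ p, φ p = ∏ j, Real.cos (p j)) :
    (∑ j, pd (pd φ j) j q = -(r : ℝ) * φ q)
    ∧ (-(∑ j, pd W j q * pd φ j q) = (r : ℝ) * ((r : ℝ) + γ - 1) * φ q)
    ∧ (∀ ℏ : ℝ, 0 < ℏ →
        -(ℏ^2/2) * (∑ j, pd (pd φ j) j q) - ℏ * (∑ j, pd W j q * pd φ j q)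
          = (r : ℝ) * ℏ * ((r : ℝ) + γ + ℏ/2 - 1) * φ q) := by
  obtain rfl : φ = fun p => ∏ j, Real.cos (p j) := funext hφ
  obtain rfl : W = _ := funext hW
  have hΔ : ∑ j, pd (pd (fun p : Fin r → ℝ => ∏ j, Real.cos (p j)) j) j q
      = -(r : ℝ) * ∏ j, Real.cos (q j) := by
    simp [pd_pd_prod_cos]
  have hA := sum_pd_prepotential_mul_pd_prod_cos γ q hqd hsin
  refine ⟨hΔ, by rw [hA, neg_neg], fun ℏ _ => ?_⟩
  rw [hΔ, hA]
  ring
end
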